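/- arXiv:2111.04252 — 2 statements merged into one kernel-verified Lean document; each statement's English description precedes it below -/
import Mathlib

section
/- Let M be a spacelike surface in ℝ^{3,1} with a canonical normal null direction Z. Then Z^⊥ is a parallel normal vector field on M (i.e. ∇⊥_X Z^⊥ = 0 for every tangent X) if and only if β ≡ 0. In particular, if Z^⊥ is a parallel normal vector field on M, then K = K_N = 0, i.e. M is flat and has flat normal bundle. -/
noncomputable section

/-- Points of the parameter domain of the surface chart. -/
abbrev Pt : Type := ℝ × ℝ

/-- Vectors of the Minkowski space `ℝ^{3,1}`. -/
abbrev E4 : Type := Fin 4 → ℝ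

/-- The Minkowski bilinear form of signature `(+,+,+,-)` on `ℝ⁴`. -/
def mink (v w : E4) : ℝ := v 0 * w 0 + v 1 * w 1 + v 2 * w 2 - v 3 * w 3

/-- Realization in `ℝ^{3,1}` of a coordinate vector field `X` along the immersion `ψ`. -/
def vecF (ψ : Pt → E4) (X : Pt → Pt) : Pt → E4 := fun p => fderiv ℝ ψ p (X p)

/-- Flat (ambient) derivative of an `ℝ⁴`-valued field along a coordinate vector field. -/
def Dflat (X : Pt → Pt) (V : Pt → E4) : Pt → E4 := fun p => fderiv ℝ V p (X p)

/-- Second fundamental form `B(X,Y) = ∇̄_X Y − ∇_X Y`. -/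
def sff (ψ : Pt → E4) (conn : (Pt → Pt) → (Pt → Pt) → Pt → Pt) (X Y : Pt → Pt) : Pt → E4 :=
  fun p => Dflat X (vecF ψ Y) p - vecF ψ (conn X Y) p

/-- `v` is tangent to the surface at `p`. -/
def isTangentV (ψ : Pt → E4) (p : Pt) (v : E4) : Prop := ∃ w : Pt, fderiv ℝ ψ p w = v

/-- `v` is normal to the surface at `p`. -/
def isNormalV (ψ : Pt → E4) (p : Pt) (v : E4) : Prop := ∀ w : Pt, mink v (fderiv ℝ ψ p w) = 0

/-- Lie bracket of coordinate vector fields on the chart. -/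
def lieB (X Y : Pt → Pt) : Pt → Pt := fun p => fderiv ℝ Y p (X p) - fderiv ℝ X p (Y p)

/-- Curvature tensor `R(X,Y)V = ∇_Y∇_X V − ∇_X∇_Y V + ∇_{[X,Y]}V`. -/
def curvR (conn : (Pt → Pt) → (Pt → Pt) → Pt → Pt) (X Y V : Pt → Pt) : Pt → Pt :=
  fun p => conn Y (conn X V) p - conn X (conn Y V) p + conn (lieB X Y) V p

/-- Normal curvature tensor `R^⊥(X,Y)ν = ∇⊥_Y∇⊥_X ν − ∇⊥_X∇⊥_Y ν + ∇⊥_{[X,Y]}ν`. -/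
def curvRperp (nconn : (Pt → Pt) → (Pt → E4) → Pt → E4) (X Y : Pt → Pt) (ν : Pt → E4) :
    Pt → E4 :=
  fun p => nconn Y (nconn X ν) p - nconn X (nconn Y ν) p + nconn (lieB X Y) ν p

/-- Determinant of four vectors of `ℝ⁴` (the volume form `e₁∧e₂∧e₃∧e₄ ↦ 1`). -/
def det4 (a b c d : E4) : ℝ := Matrix.det (Matrix.of ![a, b, c, d])

/-- A spacelike surface in `ℝ^{3,1}`, given by a chart `ψ : U → ℝ^{3,1}`, endowed with a
canonical normal null direction with respect to the constant unit spacelike vector `Z`,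
together with all the associated geometric data: the Levi-Civita connection `conn`,
the normal connection `nconn`, the tangent part `Z^⊤` (coordinates `ZT`), the oriented
orthonormal completion `W` (coordinates `Wc`), the shape operator `shA = A_{Z^⊥}`,
the 1-form `β` with `B(X,Z^⊤) = β(X)Z^⊥`, and the lightlike normal field `W'` with
`⟨Z^⊥,W'⟩ = 1`.  Each piece of data is characterized by its defining property. -/
structure CNND where
  U : Set Pt
  hUopen : IsOpen U
  ψ : Pt → E4
  hψ : ContDiffOn ℝ (⊤ : ℕ∞) ψ U
  himm : ∀ p ∈ U, ∀ v : Pt, fderiv ℝ ψ p v = 0 → v = 0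
  hspacelike : ∀ p ∈ U, ∀ v : Pt, v ≠ 0 → 0 < mink (fderiv ℝ ψ p v) (fderiv ℝ ψ p v)
  /-- Levi-Civita connection of the induced metric, as the tangent part of the flat one. -/
  conn : (Pt → Pt) → (Pt → Pt) → Pt → Pt
  hconn : ∀ X Y, ∀ p ∈ U, DifferentiableAt ℝ (vecF ψ Y) p → isNormalV ψ p (sff ψ conn X Y p)
  hconnSmooth : ∀ X Y, ContDiffOn ℝ (⊤ : ℕ∞) X U → ContDiffOn ℝ (⊤ : ℕ∞) Y U → ContDiffOn ℝ (⊤ : ℕ∞) (conn X Y) U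
  /-- Normal connection: the normal part of the flat derivative of a normal field. -/
  nconn : (Pt → Pt) → (Pt → E4) → Pt → E4
  hnconn : ∀ X ν, ∀ p ∈ U, (∀ q ∈ U, isNormalV ψ q (ν q)) → DifferentiableAt ℝ ν p →
    isNormalV ψ p (nconn X ν p) ∧ isTangentV ψ p (Dflat X ν p - nconn X ν p)
  hnconnSmooth : ∀ X ν, ContDiffOn ℝ (⊤ : ℕ∞) X U → (∀ q ∈ U, isNormalV ψ q (ν q)) →
    ContDiffOn ℝ (⊤ : ℕ∞) ν U → ContDiffOn ℝ (⊤ : ℕ∞) (nconn X ν) U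
  /-- The parallel (constant) vector field `Z`, a unit spacelike vector. -/
  Z : E4
  hZunit : mink Z Z = 1
  /-- Coordinates of the tangent part `Z^⊤` of `Z`; `Z^⊥ = Z − Z^⊤` is normal. -/
  ZT : Pt → Pt
  hZTsmooth : ContDiffOn ℝ (⊤ : ℕ∞) ZT U
  hZTtangentpart : ∀ p ∈ U, isNormalV ψ p (Z - fderiv ℝ ψ p (ZT p))
  /-- canonical normal null direction: `Z^⊥` is lightlike … -/
  hZperpNull : ∀ p ∈ U, mink (Z - fderiv ℝ ψ p (ZT p)) (Z - fderiv ℝ ψ p (ZT p)) = 0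
  /-- … and nowhere zero. -/
  hZperpNe : ∀ p ∈ U, Z - fderiv ℝ ψ p (ZT p) ≠ 0
  /-- Coordinates of the unit tangent field `W` orthogonal to `Z^⊤`, positively oriented. -/
  Wc : Pt → Pt
  hWsmooth : ContDiffOn ℝ (⊤ : ℕ∞) Wc U
  hWunit : ∀ p ∈ U, mink (fderiv ℝ ψ p (Wc p)) (fderiv ℝ ψ p (Wc p)) = 1
  hWorth : ∀ p ∈ U, mink (fderiv ℝ ψ p (ZT p)) (fderiv ℝ ψ p (Wc p)) = 0
  hWorient : ∀ p ∈ U, 0 < (ZT p).1 * (Wc p).2 - (ZT p).2 * (Wc p).1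
  /-- The shape operator `A_{Z^⊥}`: `⟨A_{Z^⊥}X, Y⟩ = ⟨B(X,Y), Z^⊥⟩`. -/
  shA : (Pt → Pt) → Pt → Pt
  hshA : ∀ X Y, ∀ p ∈ U, DifferentiableAt ℝ (vecF ψ Y) p →
    mink (fderiv ℝ ψ p (shA X p)) (fderiv ℝ ψ p (Y p)) =
      mink (sff ψ conn X Y p) (Z - fderiv ℝ ψ p (ZT p))
  /-- The 1-form `β` with `B(X, Z^⊤) = β(X) Z^⊥`. -/
  beta : Pt → Pt → ℝ
  hbeta : ∀ X, ∀ p ∈ U, sff ψ conn X ZT p = beta p (X p) • (Z - fderiv ℝ ψ p (ZT p))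
  /-- The lightlike normal field `W'` with `⟨Z^⊥, W'⟩ = 1`, such that
  `(Z^⊤, W, (Z^⊥+W')/√2, (Z^⊥−W')/√2)` is a positively oriented orthonormal frame. -/
  Wp : Pt → E4
  hWpNormal : ∀ p ∈ U, isNormalV ψ p (Wp p)
  hWpNull : ∀ p ∈ U, mink (Wp p) (Wp p) = 0
  hWpPair : ∀ p ∈ U, mink (Z - fderiv ℝ ψ p (ZT p)) (Wp p) = 1
  hWpOrient : ∀ p ∈ U, 0 < det4 (fderiv ℝ ψ p (ZT p)) (fderiv ℝ ψ p (Wc p))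
    ((Real.sqrt 2)⁻¹ • ((Z - fderiv ℝ ψ p (ZT p)) + Wp p))
    ((Real.sqrt 2)⁻¹ • ((Z - fderiv ℝ ψ p (ZT p)) - Wp p))

namespace CNND

variable (S : CNND)

/-- The normal part `Z^⊥` of `Z` along the surface. -/
def Zperp : Pt → E4 := fun p => S.Z - fderiv ℝ S.ψ p (S.ZT p)

/-- The second fundamental form of the surface. -/
def B : (Pt → Pt) → (Pt → Pt) → Pt → E4 := sff S.ψ S.conn

/-- The function `a = α(W) = ⟨B(W,W), Z^⊥⟩`. -/
def afun : Pt → ℝ := fun p => mink (S.B S.Wc S.Wc p) (S.Zperp p)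

/-- The 1-form `α(X) = ⟨B(X,W), Z^⊥⟩`. -/
def alphaF (X : Pt → Pt) : Pt → ℝ := fun p => mink (S.B X S.Wc p) (S.Zperp p)

/-- The mean curvature vector `H⃗ = (1/2)(B(Z^⊤,Z^⊤) + B(W,W))`. -/
def Hvec : Pt → E4 := fun p => (1 / 2 : ℝ) • (S.B S.ZT S.ZT p + S.B S.Wc S.Wc p)

/-- The Gauss curvature `K = ⟨R(Z^⊤,W)Z^⊤, W⟩`. -/
def Kfun : Pt → ℝ := fun p =>
  mink (fderiv ℝ S.ψ p (curvR S.conn S.ZT S.Wc S.ZT p)) (fderiv ℝ S.ψ p (S.Wc p))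

/-- The normal curvature `K_N = ⟨R^⊥(Z^⊤,W)Z^⊥, W'⟩`. -/
def KNfun : Pt → ℝ := fun p => mink (curvRperp S.nconn S.ZT S.Wc S.Zperp p) (S.Wp p)

end CNND

/-- The wedge `v ∧ w` of two vectors of `ℝ⁴`, as an antisymmetric matrix (bivector). -/
def wedge2 (v w : E4) : Fin 4 → Fin 4 → ℝ := fun i j => v i * w j - v j * w i

/-- The Gauss map `G = Z^⊤ ∧ W : M → Λ²ℝ^{3,1}`. -/
def CNND.Gmap (S : CNND) : Pt → Fin 4 → Fin 4 → ℝ :=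
  fun p => wedge2 (fderiv ℝ S.ψ p (S.ZT p)) (fderiv ℝ S.ψ p (S.Wc p))

/-- The signs of the Minkowski metric. -/
def epsM : Fin 4 → ℝ := fun i => if i = 3 then -1 else 1

/-- The induced (signature `(3,3)`) inner product on bivectors of `ℝ^{3,1}`:
`⟨v∧w, v'∧w'⟩ = ⟨v,v'⟩⟨w,w'⟩ − ⟨v,w'⟩⟨w,v'⟩`. -/
def binner (η η' : Fin 4 → Fin 4 → ℝ) : ℝ :=
  (1 / 2) * ∑ i : Fin 4, ∑ j : Fin 4, epsM i * epsM j * η i j * η' i j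

/-- The wedge product `Λ²ℝ^{3,1} × Λ²ℝ^{3,1} → Λ⁴ℝ^{3,1} ≅ ℝ`, normalized so that
`(v∧w)∧(v'∧w') = det(v,w,v',w')`. -/
def bwedge (η η' : Fin 4 → Fin 4 → ℝ) : ℝ :=
  (1 / 4) * ∑ σ : Equiv.Perm (Fin 4),
    ((Equiv.Perm.sign σ : ℤ) : ℝ) * η (σ 0) (σ 1) * η' (σ 2) (σ 3)

/-- The `ℂ`-bilinear form `H(η,η') = ⟨η,η'⟩ + i η∧η'` on bivectors, where `i = −⋆`. -/
def HformC (η η' : Fin 4 → Fin 4 → ℝ) : ℂ :=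
  (binner η η' : ℝ) + (bwedge η η' : ℝ) * Complex.I

/-- The quadratic form `δ(u) = dG(u) ∧ dG(u)` whose zero directions are the asymptotic
directions. -/
def CNND.deltaQ (S : CNND) (p : Pt) (u : Pt) : ℝ :=
  bwedge (fderiv ℝ S.Gmap p u) (fderiv ℝ S.Gmap p u)

theorem mink_add_left (u v w : E4) : mink (u + v) w = mink u w + mink v w := by
  simp only [mink, Pi.add_apply]; ring

theorem mink_sub_left (u v w : E4) : mink (u - v) w = mink u w - mink v w := by
  simp only [mink, Pi.sub_apply]; ring

theorem mink_zero_left (w : E4) : mink 0 w = 0 := by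
  simp [mink]

theorem mink_smul_left (c : ℝ) (v w : E4) : mink (c • v) w = c * mink v w := by
  simp only [mink, Pi.smul_apply, smul_eq_mul]; ring

/-- The flat connection is curvature free. -/
theorem Dflat_Dflat_sub_add_lieB {V : Pt → E4} {X Y : Pt → Pt} {p : Pt}
    (hV : ContDiffAt ℝ 2 V p) (hX : DifferentiableAt ℝ X p) (hY : DifferentiableAt ℝ Y p) :
    Dflat Y (Dflat X V) p - Dflat X (Dflat Y V) p + Dflat (lieB X Y) V p = 0 := by
  have hdV : DifferentiableAt ℝ (fderiv ℝ V) p :=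
    (hV.fderiv_right (m := 1) (by norm_num)).differentiableAt (by norm_num)
  have key : ∀ A C : Pt → Pt, DifferentiableAt ℝ A p →
      Dflat C (Dflat A V) p
        = fderiv ℝ (fderiv ℝ V) p (C p) (A p) + fderiv ℝ V p (fderiv ℝ A p (C p)) := by
    intro A C hA
    have : fderiv ℝ (Dflat A V) p
        = (fderiv ℝ V p).comp (fderiv ℝ A p) + (fderiv ℝ (fderiv ℝ V) p).flip (A p) :=
      fderiv_clm_apply hdV hA
    simp only [Dflat] at this ⊢
    rw [this]
    simp [add_comm]
  have hsymm : fderiv ℝ (fderiv ℝ V) p (Y p) (X p) = fderiv ℝ (fderiv ℝ V) p (X p) (Y p) :=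
    (hV.isSymmSndFDerivAt (by simp)) (Y p) (X p)
  rw [key X Y hX, key Y X hY, hsymm]
  simp only [Dflat, lieB, map_sub]
  abel

namespace CNND

variable (S : CNND)

theorem eq_zero_of_isNormalV_of_isTangentV {p : Pt} (hp : p ∈ S.U) {v : E4}
    (hn : isNormalV S.ψ p v) (ht : isTangentV S.ψ p v) : v = 0 := by
  obtain ⟨w, rfl⟩ := ht
  by_contra hw
  have hw0 : w ≠ 0 := by
    rintro rfl
    exact hw (map_zero _)
  exact (S.hspacelike p hp w hw0).ne' (hn w)

theorem contDiffOn_vecF {Y : Pt → Pt} (hY : ContDiffOn ℝ (⊤ : ℕ∞) Y S.U) :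
    ContDiffOn ℝ (⊤ : ℕ∞) (vecF S.ψ Y) S.U :=
  (S.hψ.fderiv_of_isOpen S.hUopen (m := (⊤ : ℕ∞)) (by norm_cast)).clm_apply hY

theorem contDiffOn_Dflat {X : Pt → Pt} {V : Pt → E4} (hX : ContDiffOn ℝ (⊤ : ℕ∞) X S.U)
    (hV : ContDiffOn ℝ (⊤ : ℕ∞) V S.U) : ContDiffOn ℝ (⊤ : ℕ∞) (Dflat X V) S.U :=
  (hV.fderiv_of_isOpen S.hUopen (m := (⊤ : ℕ∞)) (by norm_cast)).clm_apply hX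

theorem differentiableAt_of_contDiffOn {F : Type*} [NormedAddCommGroup F] [NormedSpace ℝ F]
    {f : Pt → F} (hf : ContDiffOn ℝ (⊤ : ℕ∞) f S.U) {p : Pt} (hp : p ∈ S.U) :
    DifferentiableAt ℝ f p :=
  (hf.contDiffAt (S.hUopen.mem_nhds hp)).differentiableAt (by simp)

/-- `∇⊥_X Z^⊥ = -β(X) Z^⊥`. -/
theorem nconn_Zperp (X : Pt → Pt) {p : Pt} (hp : p ∈ S.U) :
    S.nconn X S.Zperp p = -(S.beta p (X p) • S.Zperp p) := by
  have hdiff := S.differentiableAt_of_contDiffOn (S.contDiffOn_vecF S.hZTsmooth) hp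
  have hZ : S.Zperp = fun q => S.Z - vecF S.ψ S.ZT q := rfl
  have hD : Dflat X S.Zperp p = -Dflat X (vecF S.ψ S.ZT) p := by
    simp only [Dflat, hZ, fderiv_const_sub, neg_apply]
  obtain ⟨hn, w, hw⟩ := S.hnconn X S.Zperp p hp S.hZTtangentpart (by
    rw [hZ]
    exact hdiff.const_sub _)
  have hb : Dflat X (vecF S.ψ S.ZT) p - vecF S.ψ (S.conn X S.ZT) p
      = S.beta p (X p) • S.Zperp p := S.hbeta X p hp
  have hzero : S.nconn X S.Zperp p + S.beta p (X p) • S.Zperp p = 0 := by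
    refine S.eq_zero_of_isNormalV_of_isTangentV hp (fun u => ?_) ⟨-w - S.conn X S.ZT p, ?_⟩
    · rw [mink_add_left, mink_smul_left, hn u,
        show mink (S.Zperp p) _ = 0 from S.hZTtangentpart p hp u]
      simp
    · rw [map_sub, map_neg, hw, hD, ← hb]
      simp only [vecF]
      abel
  exact eq_neg_of_add_eq_zero_left hzero

theorem nconn_eq_zero_of_eqOn_zero {ν : Pt → E4} (hν : ∀ q ∈ S.U, ν q = 0) (X : Pt → Pt)
    {p : Pt} (hp : p ∈ S.U) : S.nconn X ν p = 0 := by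
  have hev : ν =ᶠ[nhds p] fun _ => 0 :=
    Filter.eventually_of_mem (S.hUopen.mem_nhds hp) hν
  obtain ⟨hn, w, hw⟩ := S.hnconn X ν p hp
    (fun q hq u => by rw [hν q hq, mink_zero_left])
    (hev.differentiableAt_iff.mpr (differentiableAt_const _))
  refine S.eq_zero_of_isNormalV_of_isTangentV hp hn ⟨-w, ?_⟩
  rw [map_neg, hw, Dflat, hev.fderiv_eq]
  simp

theorem KNfun_eq_zero_of_parallel (h : ∀ X : Pt → Pt, ∀ p ∈ S.U, S.nconn X S.Zperp p = 0)
    {p : Pt} (hp : p ∈ S.U) : S.KNfun p = 0 := by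
  simp only [KNfun, curvRperp]
  rw [S.nconn_eq_zero_of_eqOn_zero (h S.ZT) _ hp, S.nconn_eq_zero_of_eqOn_zero (h S.Wc) _ hp,
    h _ p hp]
  simp [mink_zero_left]

theorem mink_vecF_conn {X Y : Pt → Pt} {p : Pt} (hp : p ∈ S.U)
    (hY : DifferentiableAt ℝ (vecF S.ψ Y) p) (u : Pt) :
    mink (fderiv ℝ S.ψ p (S.conn X Y p)) (fderiv ℝ S.ψ p u)
      = mink (Dflat X (vecF S.ψ Y) p) (fderiv ℝ S.ψ p u) := by
  have h := S.hconn X Y p hp hY u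
  rw [sff, mink_sub_left] at h
  exact (sub_eq_zero.mp h).symm

theorem Kfun_eq_zero_of_beta_eq_zero (h : ∀ p ∈ S.U, ∀ v : Pt, S.beta p v = 0)
    {p : Pt} (hp : p ∈ S.U) : S.Kfun p = 0 := by
  have hV := S.contDiffOn_vecF S.hZTsmooth
  have hconn : ∀ X : Pt → Pt,
      vecF S.ψ (S.conn X S.ZT) =ᶠ[nhds p] Dflat X (vecF S.ψ S.ZT) := by
    intro X
    refine Filter.eventually_of_mem (S.hUopen.mem_nhds hp) fun q hq => ?_
    have hb := S.hbeta X q hq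
    rw [h q hq, zero_smul, sff] at hb
    exact (sub_eq_zero.mp hb).symm
  have hconn₂ : ∀ X Y : Pt → Pt, ContDiffOn ℝ (⊤ : ℕ∞) X S.U → ∀ u : Pt,
      mink (fderiv ℝ S.ψ p (S.conn Y (S.conn X S.ZT) p)) (fderiv ℝ S.ψ p u)
        = mink (Dflat Y (Dflat X (vecF S.ψ S.ZT)) p) (fderiv ℝ S.ψ p u) := by
    intro X Y hX u
    rw [S.mink_vecF_conn hp ((hconn X).differentiableAt_iff.mpr
      (S.differentiableAt_of_contDiffOn (S.contDiffOn_Dflat hX hV) hp))]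
    simp only [Dflat, (hconn X).fderiv_eq]
  have hflat := Dflat_Dflat_sub_add_lieB (X := S.ZT) (Y := S.Wc)
    ((hV.contDiffAt (S.hUopen.mem_nhds hp)).of_le (by norm_cast))
    (S.differentiableAt_of_contDiffOn S.hZTsmooth hp)
    (S.differentiableAt_of_contDiffOn S.hWsmooth hp)
  rw [Kfun, curvR, map_add, map_sub, mink_add_left, mink_sub_left,
    hconn₂ _ _ S.hZTsmooth, hconn₂ _ _ S.hWsmooth,
    S.mink_vecF_conn hp (S.differentiableAt_of_contDiffOn hV hp),
    ← mink_sub_left, ← mink_add_left, hflat, mink_zero_left]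

end CNND

/-- `Z^⊥` is a parallel normal vector field on `M` (i.e. `∇⊥_X Z^⊥ = 0` for
every tangent `X`) if and only if `β ≡ 0`.  In particular, if `Z^⊥` is a parallel normal
vector field on `M`, then `K = K_N = 0`, i.e. `M` is flat and has flat normal bundle. -/
theorem cnnd_parallel_Zperp_iff_beta_zero (S : CNND) :
    ((∀ X : Pt → Pt, ∀ p ∈ S.U, S.nconn X S.Zperp p = 0) ↔
      (∀ p ∈ S.U, ∀ v : Pt, S.beta p v = 0)) ∧
    ((∀ X : Pt → Pt, ∀ p ∈ S.U, S.nconn X S.Zperp p = 0) →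
      ∀ p ∈ S.U, S.Kfun p = 0 ∧ S.KNfun p = 0) := by
  have hiff : (∀ X : Pt → Pt, ∀ p ∈ S.U, S.nconn X S.Zperp p = 0) ↔
      (∀ p ∈ S.U, ∀ v : Pt, S.beta p v = 0) := by
    refine ⟨fun h p hp v => ?_, fun h X p hp => ?_⟩
    · have hv := h (fun _ => v) p hp
      rw [S.nconn_Zperp _ hp, neg_eq_zero] at hv
      exact (smul_eq_zero.mp hv).resolve_right (S.hZperpNe p hp)
    · rw [S.nconn_Zperp X hp, h p hp, zero_smul, neg_zero]
  exact ⟨hiff, fun h p hp =>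
    ⟨S.Kfun_eq_zero_of_beta_eq_zero (hiff.mp h) hp, S.KNfun_eq_zero_of_parallel h hp⟩⟩


end
end

section
/- Let M be a spacelike surface in ℝ^{3,1} with a canonical normal null direction Z. Then the mean curvature vector and the Gauss curvature of M satisfy 4|H⃗|² − 2K = |B(W,W)|², where |v|² := ⟨v,v⟩ for a normal vector v. -/
noncomputable section

theorem mink_comm (v w : E4) : mink v w = mink w v := by
  simp only [mink]; ring

theorem mink_add_right (u v w : E4) : mink u (v + w) = mink u v + mink u w := by
  rw [mink_comm, mink_add_left, mink_comm v, mink_comm w]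

theorem mink_smul_right (c : ℝ) (v w : E4) : mink v (c • w) = c * mink v w := by
  rw [mink_comm, mink_smul_left, mink_comm w]

theorem mink_fderiv_eq_neg {f g : Pt → E4} {p : Pt} (hf : DifferentiableAt ℝ f p)
    (hg : DifferentiableAt ℝ g p) (h : ∀ᶠ q in nhds p, mink (f q) (g q) = 0) (v : Pt) :
    mink (fderiv ℝ f p v) (g p) = -mink (f p) (fderiv ℝ g p v) := by
  have hF := hasFDerivAt_pi'.1 hf.hasFDerivAt
  have hG := hasFDerivAt_pi'.1 hg.hasFDerivAt
  have hprod := ((((hF 0).mul (hG 0)).add ((hF 1).mul (hG 1))).add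
    ((hF 2).mul (hG 2))).sub ((hF 3).mul (hG 3))
  have hzero : HasFDerivAt (fun q => mink (f q) (g q)) (0 : Pt →L[ℝ] ℝ) p :=
    (hasFDerivAt_const (0 : ℝ) p).congr_of_eventuallyEq h
  have key := congrArg (fun L : Pt →L[ℝ] ℝ => L v) (hprod.unique hzero)
  simp at key
  simp only [mink]
  linarith

theorem fderiv_fderiv_apply {V : Pt → E4} {X : Pt → Pt} {p : Pt}
    (hV : DifferentiableAt ℝ (fderiv ℝ V) p) (hX : DifferentiableAt ℝ X p) (v : Pt) :
    fderiv ℝ (fun q => fderiv ℝ V q (X q)) p v =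
      fderiv ℝ (fderiv ℝ V) p v (X p) + fderiv ℝ V p (fderiv ℝ X p v) := by
  rw [fderiv_clm_apply hV hX]
  simp [add_comm]

/-- The ambient connection is flat. -/
theorem Dflat_comm {V : Pt → E4} {X Y : Pt → Pt} {p : Pt}
    (hV : ContDiffAt ℝ (⊤ : ℕ∞) V p) (hX : DifferentiableAt ℝ X p)
    (hY : DifferentiableAt ℝ Y p) :
    Dflat Y (Dflat X V) p - Dflat X (Dflat Y V) p + Dflat (lieB X Y) V p = 0 := by
  have hV' : DifferentiableAt ℝ (fderiv ℝ V) p :=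
    (hV.fderiv_right (m := 1) (by norm_cast)).differentiableAt (by simp)
  have hsymm : IsSymmSndFDerivAt ℝ V p := hV.isSymmSndFDerivAt <| by
    rw [minSmoothness_of_isRCLikeNormedField]
    exact WithTop.coe_le_coe.2 (le_top : (2 : ℕ∞) ≤ ⊤)
  unfold Dflat lieB
  rw [fderiv_fderiv_apply hV' hX, fderiv_fderiv_apply hV' hY, hsymm.eq (Y p) (X p), map_sub]
  abel

/-- The ambient connection is torsion-free. -/
theorem Dflat_vecF_sub {ψ : Pt → E4} {X Y : Pt → Pt} {p : Pt}
    (hψ : ContDiffAt ℝ (⊤ : ℕ∞) ψ p) (hX : DifferentiableAt ℝ X p)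
    (hY : DifferentiableAt ℝ Y p) :
    Dflat X (vecF ψ Y) p = Dflat Y (vecF ψ X) p + fderiv ℝ ψ p (lieB X Y p) := by
  have h := Dflat_comm hψ hX hY
  have e (A : Pt → Pt) : Dflat A ψ = vecF ψ A := rfl
  rw [e, e, e] at h
  rw [show fderiv ℝ ψ p (lieB X Y p) = vecF ψ (lieB X Y) p from rfl]
  rw [sub_add_eq_add_sub, sub_eq_zero] at h
  exact h.symm

theorem ContDiffOn.fderiv_apply_field {V : Pt → E4} {X : Pt → Pt} {U : Set Pt}
    (hU : IsOpen U) (hV : ContDiffOn ℝ (⊤ : ℕ∞) V U) (hX : ContDiffOn ℝ (⊤ : ℕ∞) X U) :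
    ContDiffOn ℝ (⊤ : ℕ∞) (fun q => fderiv ℝ V q (X q)) U :=
  (hV.fderiv_of_isOpen hU (by norm_cast)).clm_apply hX

namespace CNND

variable (S : CNND)

/-- Gauss equation: `⟨R(X,Y)V, A⟩ = ⟨B(X,V), B(Y,A)⟩ - ⟨B(Y,V), B(X,A)⟩`. -/
theorem gauss_equation {X Y V A : Pt → Pt} (hX : ContDiffOn ℝ (⊤ : ℕ∞) X S.U)
    (hY : ContDiffOn ℝ (⊤ : ℕ∞) Y S.U) (hV : ContDiffOn ℝ (⊤ : ℕ∞) V S.U)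
    (hA : ContDiffOn ℝ (⊤ : ℕ∞) A S.U) {p : Pt} (hp : p ∈ S.U) :
    mink (fderiv ℝ S.ψ p (curvR S.conn X Y V p)) (fderiv ℝ S.ψ p (A p)) =
      mink (S.B X V p) (S.B Y A p) - mink (S.B Y V p) (S.B X A p) := by
  have hnhds {q : Pt} (hq : q ∈ S.U) : S.U ∈ nhds q := S.hUopen.mem_nhds hq
  have diff {F : Type} [NormedAddCommGroup F] [NormedSpace ℝ F] {f : Pt → F}
      (hf : ContDiffOn ℝ (⊤ : ℕ∞) f S.U) {q : Pt} (hq : q ∈ S.U) : DifferentiableAt ℝ f q :=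
    (hf.contDiffAt (hnhds hq)).differentiableAt (by simp)
  have hvec {C : Pt → Pt} (hC : ContDiffOn ℝ (⊤ : ℕ∞) C S.U) :
      ContDiffOn ℝ (⊤ : ℕ∞) (vecF S.ψ C) S.U := S.hψ.fderiv_apply_field S.hUopen hC
  have hnormal (C : Pt → Pt) {D : Pt → Pt} (hD : ContDiffOn ℝ (⊤ : ℕ∞) D S.U) {q : Pt}
      (hq : q ∈ S.U) : isNormalV S.ψ q (S.B C D q) := S.hconn C D q hq (diff (hvec hD) hq)
  have hsplit (C D : Pt → Pt) (q : Pt) :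
      Dflat C (vecF S.ψ D) q = vecF S.ψ (S.conn C D) q + S.B C D q := by
    simp [B, sff]
  have htangent (C : Pt → Pt) {D : Pt → Pt} (hD : ContDiffOn ℝ (⊤ : ℕ∞) D S.U) :
      mink (Dflat C (vecF S.ψ D) p) (fderiv ℝ S.ψ p (A p)) =
        mink (vecF S.ψ (S.conn C D) p) (fderiv ℝ S.ψ p (A p)) := by
    rw [hsplit, mink_add_left, hnormal C hD hp, add_zero]
  have hsecond {C D : Pt → Pt} (hC : ContDiffOn ℝ (⊤ : ℕ∞) C S.U) :
      mink (Dflat D (Dflat C (vecF S.ψ V)) p) (fderiv ℝ S.ψ p (A p)) =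
        mink (vecF S.ψ (S.conn D (S.conn C V)) p) (fderiv ℝ S.ψ p (A p)) -
          mink (S.B C V p) (S.B D A p) := by
    have hCV := S.hconnSmooth C V hC hV
    have hBsmooth : ContDiffOn ℝ (⊤ : ℕ∞) (S.B C V) S.U :=
      ((hvec hV).fderiv_apply_field S.hUopen hC).sub (hvec hCV)
    have hfun : Dflat C (vecF S.ψ V) = vecF S.ψ (S.conn C V) + S.B C V :=
      funext (hsplit C V)
    have hderiv : Dflat D (Dflat C (vecF S.ψ V)) p =
        Dflat D (vecF S.ψ (S.conn C V)) p + Dflat D (S.B C V) p := by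
      rw [hfun]
      simp only [Dflat]
      rw [fderiv_add (diff (hvec hCV) hp) (diff hBsmooth hp)]
      rfl
    have hweingarten : mink (Dflat D (S.B C V) p) (fderiv ℝ S.ψ p (A p)) =
        -mink (S.B C V p) (Dflat D (vecF S.ψ A) p) :=
      mink_fderiv_eq_neg (g := vecF S.ψ A) (diff hBsmooth hp) (diff (hvec hA) hp)
        (Filter.eventually_of_mem (hnhds hp) fun q hq => hnormal C hV hq (A q)) (D p)
    have hnt : mink (S.B C V p) (vecF S.ψ (S.conn D A) p) = 0 := hnormal C hV hp _
    rw [hderiv, mink_add_left, htangent D hCV, hweingarten, hsplit, mink_add_right, hnt]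
    ring
  have hflat := congrArg (fun v => mink v (fderiv ℝ S.ψ p (A p)))
    (Dflat_comm ((hvec hV).contDiffAt (hnhds hp)) (diff hX hp) (diff hY hp))
  have hzero : mink 0 (fderiv ℝ S.ψ p (A p)) = 0 := by simp [mink]
  simp only [mink_add_left, mink_sub_left, hzero] at hflat
  rw [hsecond hX, hsecond hY, htangent _ hV] at hflat
  simp only [vecF] at hflat
  rw [curvR, map_add, map_sub, mink_add_left, mink_sub_left]
  linarith

/-- The second fundamental form is symmetric. -/
theorem mink_B_comm {X Y : Pt → Pt} (hX : ContDiffOn ℝ (⊤ : ℕ∞) X S.U)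
    (hY : ContDiffOn ℝ (⊤ : ℕ∞) Y S.U) {p : Pt} (hp : p ∈ S.U) {ν : E4}
    (hν : isNormalV S.ψ p ν) : mink ν (S.B X Y p) = mink ν (S.B Y X p) := by
  have hU := S.hUopen.mem_nhds hp
  have h := Dflat_vecF_sub (S.hψ.contDiffAt hU)
    ((hX.contDiffAt hU).differentiableAt (by simp))
    ((hY.contDiffAt hU).differentiableAt (by simp))
  have hn (w : Pt) : mink (fderiv ℝ S.ψ p w) ν = 0 := by rw [mink_comm, hν w]
  rw [mink_comm ν, mink_comm ν]
  simp only [B, sff, vecF, mink_sub_left, hn] at h ⊢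
  rw [h, mink_add_left, hn, add_zero]

/-- `K = ⟨B(Z^⊤,Z^⊤), B(W,W)⟩`, since `B(W,Z^⊤)` is a multiple of the null vector `Z^⊥`. -/
theorem Kfun_eq {p : Pt} (hp : p ∈ S.U) :
    S.Kfun p = mink (S.B S.ZT S.ZT p) (S.B S.Wc S.Wc p) := by
  have hB : S.B S.Wc S.ZT p = _ := S.hbeta S.Wc p hp
  have hnormal : isNormalV S.ψ p (S.B S.Wc S.ZT p) := by
    intro w
    rw [hB, mink_smul_left, S.hZTtangentpart p hp w, mul_zero]
  rw [Kfun, S.gauss_equation S.hZTsmooth S.hWsmooth S.hZTsmooth S.hWsmooth hp,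
    S.mink_B_comm S.hZTsmooth S.hWsmooth hp hnormal, hB, mink_smul_left, mink_smul_right,
    S.hZperpNull p hp]
  ring

end CNND

/-- The mean curvature vector and the Gauss curvature of `M` satisfy
`4|H⃗|² − 2K = |B(W,W)|²`. -/
theorem cnnd_mean_curvature_gauss_identity (S : CNND) :
    ∀ p ∈ S.U,
      4 * mink (S.Hvec p) (S.Hvec p) - 2 * S.Kfun p =
        mink (S.B S.Wc S.Wc p) (S.B S.Wc S.Wc p) := by
  intro p hp
  have hB : S.B S.ZT S.ZT p = _ := S.hbeta S.ZT p hp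
  have hnull : mink (S.B S.ZT S.ZT p) (S.B S.ZT S.ZT p) = 0 := by
    rw [hB, mink_smul_left, mink_smul_right, S.hZperpNull p hp]
    ring
  rw [S.Kfun_eq hp, CNND.Hvec, mink_smul_left, mink_smul_right, mink_add_left,
    mink_add_right, mink_add_right, hnull, mink_comm (S.B S.Wc S.Wc p) (S.B S.ZT S.ZT p)]
  ring

end
end
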